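/- Let p be any probability vector on {1,…,k}. For every n≥1 and every x∈W∩ℤ_+^k with |x|=n: P((G^{(k)}(X))(n)=x) = s_{x^*}(p)·f(x), where f(x) is the number of paths g:{0,…,n}→ℤ_+^k with g(0)=0, g(m)−g(m−1)∈{e_1,…,e_k} for all 1≤m≤n, g(m)∈W for all m, and g(n)=x (equivalently, f(x) is the number of standard Young tableaux of shape x^*). -/

import Mathlib

open MeasureTheory ProbabilityTheory

noncomputable def minOp (x y : ℕ → ℤ) : ℕ → ℤ := fun n =>
  Finset.inf' (Finset.range (n+1)) (by simp) (fun m => x m + y n - y m)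

noncomputable def maxOp (x y : ℕ → ℤ) : ℕ → ℤ := fun n =>
  Finset.sup' (Finset.range (n+1)) (by simp) (fun m => x m + y n - y m)

/-- `Dseq x i = x 0 ⊓ x 1 ⊓ ⋯ ⊓ x i` (left to right). -/
noncomputable def Dseq (x : ℕ → ℕ → ℤ) : ℕ → (ℕ → ℤ)
  | 0 => x 0
  | i+1 => minOp (Dseq x i) (x (i+1))

/-- `Tseq x i = x (i+1) ⊔ (x 0 ⊓ ⋯ ⊓ x i)`. -/
noncomputable def Tseq (x : ℕ → ℕ → ℤ) : ℕ → (ℕ → ℤ) :=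
  fun i => maxOp (x (i+1)) (Dseq x i)

/-- The path transformation `G^{(k)}` (coordinates `0,…,k-1`). -/
noncomputable def G : ℕ → (ℕ → ℕ → ℤ) → (ℕ → ℕ → ℤ)
  | 0, x => x
  | 1, x => x
  | (k+2), x => fun i => match i with
      | 0 => Dseq x (k+1)
      | (j+1) => G (k+1) (Tseq x) j

/-- The cells of the Young diagram of shape `lam` (row lengths), within the
first `k` rows. -/
def cells (k : ℕ) (lam : ℕ → ℕ) : Finset (ℕ × ℕ) :=
  (Finset.range k ×ˢ Finset.range ((Finset.range k).sup lam)).filter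
    (fun rc => rc.2 < lam rc.1)

/-- `T` is a semistandard Young tableau of shape `lam` with entries in
`{0,…,k-1}` (0-based version of entries `{1,…,k}`): rows weakly increase,
columns strictly increase, and `T` vanishes outside the diagram. -/
def IsSSYT (k : ℕ) (lam : ℕ → ℕ) (T : ℕ → ℕ → ℕ) : Prop :=
  (∀ r c, c < lam r → T r c < k) ∧
  (∀ r c, ¬ c < lam r → T r c = 0) ∧
  (∀ r c c', c ≤ c' → c' < lam r → T r c ≤ T r c') ∧
  (∀ r r' c, r < r' → c < lam r' → T r c < T r' c)

/-- Number of entries of `T` (of shape `lam`, within `k` rows) equal to `i`. -/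
def entryCount (k : ℕ) (lam : ℕ → ℕ) (T : ℕ → ℕ → ℕ) (i : ℕ) : ℕ :=
  ((cells k lam).filter (fun rc => T rc.1 rc.2 = i)).card

/-- The Schur polynomial `s_lam(p) = ∑_T p^{weight(T)}`, summing over all
semistandard tableaux of shape `lam` with entries in `{0,…,k-1}`. -/
noncomputable def schur (k : ℕ) (lam : ℕ → ℕ) (p : ℕ → ℝ) : ℝ :=
  ∑' T : {T : ℕ → ℕ → ℕ // IsSSYT k lam T},
    ∏ i ∈ Finset.range k, p i ^ entryCount k lam T.1 i

/-- The Kostka number `κ_{lam,w}`: the number of semistandard tableaux of shape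
`lam` with entries in `{0,…,k-1}` and weight `w`. -/
noncomputable def kostka (k : ℕ) (lam : ℕ → ℕ) (w : ℕ → ℕ) : ℕ :=
  Set.ncard {T : ℕ → ℕ → ℕ | IsSSYT k lam T ∧ ∀ i, i < k → entryCount k lam T i = w i}

/-- The reversed vector `x^*` of a nonnegative integer vector, as a shape. -/
def revPartZ (k : ℕ) (x : ℕ → ℤ) : ℕ → ℕ :=
  fun j => if j < k then (x (k-1-j)).toNat else 0

/-- The reversed vector `x^*` of `x ∈ ℤ_+^k`, as a shape. -/
def revPart (k : ℕ) (x : ℕ → ℕ) : ℕ → ℕ :=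
  fun j => if j < k then x (k-1-j) else 0

/-- The counting walk of the i.i.d. letters `ξ`:
`Xcnt ξ i n ω = #{m < n : ξ m ω = i}` (as an integer). -/
def Xcnt {Ω : Type*} (ξ : ℕ → Ω → ℕ) (i : ℕ) (n : ℕ) (ω : Ω) : ℤ :=
  ((((Finset.range n).filter (fun m => ξ m ω = i))).card : ℤ)

/-- The number of paths from the origin to `x` of length `n`, with unit
increments, staying in the Weyl chamber (normalised to vanish outside
`{0,…,k-1} × {0,…,n}`); this is the number of standard Young tableaux of
shape `x^*`. -/
noncomputable def numChamberPaths (k n : ℕ) (x : ℕ → ℕ) : ℕ :=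
  Set.ncard {g : ℕ → ℕ → ℤ |
    (∀ i m, k ≤ i ∨ n < m → g i m = 0) ∧
    (∀ i, i < k → g i 0 = 0) ∧
    (∀ m, 1 ≤ m → m ≤ n →
      ∃ j, j < k ∧ g j m = g j (m-1) + 1 ∧ ∀ i, i < k → i ≠ j → g i m = g i (m-1)) ∧
    (∀ m ≤ n, ∀ i, i + 1 < k → g i m ≤ g (i+1) m) ∧
    (∀ i, i < k → g i n = (x i : ℤ))}


/-- Interlacing triangular arrays of depth `k`. -/
def IsGT (k : ℕ) (z : ℕ → ℕ → ℕ) : Prop :=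
  ∀ i, i < k → ∀ l, l < i → z (i+1) l ≤ z i l ∧ z i l ≤ z (i+1) (l+1)

/-- Agreement of arrays up to row `k`. -/
def EqUp (k : ℕ) (y z : ℕ → ℕ → ℕ) : Prop :=
  ∀ i, i ≤ k → ∀ l, l < i → y i l = z i l

/-- Weakly increasing rows of length `k`. -/
def Chamb (k : ℕ) (v : ℕ → ℕ) : Prop := ∀ l, l + 1 < k → v l ≤ v (l+1)

/-- `v - e_r`. -/
def decr (v : ℕ → ℕ) (r : ℕ) : ℕ → ℕ := fun l => if l = r then v l - 1 else v l

theorem nxt_ex (y : ℕ → ℕ → ℕ) (i s : ℕ) : ∃ l, s ≤ l ∧ (i ≤ l ∨ y (i+1) l < y i l) :=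
  ⟨max s i, le_max_left _ _, Or.inl (le_max_right _ _)⟩

open Classical in
/-- The first admissible position of row `i+1` at or after `s`. -/
noncomputable def nxt (y : ℕ → ℕ → ℕ) (i s : ℕ) : ℕ := Nat.find (nxt_ex y i s)

theorem nxt_ge (y : ℕ → ℕ → ℕ) (i s : ℕ) : s ≤ nxt y i s := by
  classical exact (Nat.find_spec (nxt_ex y i s)).1

theorem nxt_cond (y : ℕ → ℕ → ℕ) (i s : ℕ) :
    i ≤ nxt y i s ∨ y (i+1) (nxt y i s) < y i (nxt y i s) := by
  classical exact (Nat.find_spec (nxt_ex y i s)).2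

theorem nxt_min (y : ℕ → ℕ → ℕ) (i s l : ℕ) (h1 : s ≤ l) (h2 : l < nxt y i s) :
    l < i ∧ y i l ≤ y (i+1) l := by
  classical
  have := Nat.find_min (nxt_ex y i s) h2
  push Not at this
  exact this h1

theorem nxt_le (y : ℕ → ℕ → ℕ) (i s : ℕ) (h : s ≤ i) : nxt y i s ≤ i := by
  by_contra hc
  have := nxt_min y i s i h (by omega)
  omega

theorem nxt_eq (y : ℕ → ℕ → ℕ) (i s r : ℕ) (h1 : s ≤ r) (h2 : i ≤ r ∨ y (i+1) r < y i r)
    (h3 : ∀ l, s ≤ l → l < r → l < i ∧ y i l ≤ y (i+1) l) : nxt y i s = r := by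
  rcases lt_trichotomy (nxt y i s) r with h | h | h
  · have := h3 _ (nxt_ge y i s) h
    have := nxt_cond y i s
    omega
  · exact h
  · have := nxt_min y i s r h1 h
    omega

/-- `sPos y j i = l+1` if the insertion of letter `j` moves position `l` in row `i`,
and `0` if row `i` is untouched. -/
noncomputable def sPos (y : ℕ → ℕ → ℕ) (j : ℕ) : ℕ → ℕ
  | 0 => 0
  | i+1 => if sPos y j i = 0 ∧ i ≠ j then 0 else nxt y i (sPos y j i) + 1

/-- Insertion of letter `j`. -/
noncomputable def ins (y : ℕ → ℕ → ℕ) (j : ℕ) : ℕ → ℕ → ℕ :=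
  fun i l => y i l + if sPos y j i = l + 1 then 1 else 0

theorem sPos_zero (y : ℕ → ℕ → ℕ) (j i : ℕ) (h : i ≤ j) : sPos y j i = 0 := by
  induction i with
  | zero => rfl
  | succ i ih =>
    rw [sPos, if_pos ⟨ih (by omega), by omega⟩]

theorem sPos_succ (y : ℕ → ℕ → ℕ) (j i : ℕ) (h : j ≤ i) :
    sPos y j (i+1) = nxt y i (sPos y j i) + 1 := by
  induction i with
  | zero =>
    have : j = 0 := by omega
    subst this
    simp [sPos]
  | succ i ih =>
    rw [sPos, if_neg]
    rintro ⟨h1, h2⟩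
    rw [ih (by omega)] at h1
    omega

theorem sPos_le (y : ℕ → ℕ → ℕ) (j i : ℕ) : sPos y j i ≤ i := by
  induction i with
  | zero => simp [sPos]
  | succ i ih =>
    rw [sPos]
    split_ifs
    · omega
    · have := nxt_le y i _ ih
      omega

theorem sPos_pos (y : ℕ → ℕ → ℕ) (j i : ℕ) (h : j < i) : 0 < sPos y j i := by
  obtain ⟨i, rfl⟩ : ∃ i', i = i' + 1 := ⟨i - 1, by omega⟩
  rw [sPos_succ _ _ _ (by omega)]
  omega

theorem IsGT.mono {k k' : ℕ} {z : ℕ → ℕ → ℕ} (h : IsGT k' z) (hk : k ≤ k') : IsGT k z :=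
  fun i hi l hl => h i (by omega) l hl

theorem IsGT.chamb {k : ℕ} {z : ℕ → ℕ → ℕ} (h : IsGT k z) : Chamb k (z k) := by
  intro l hl
  obtain ⟨k, rfl⟩ : ∃ i', k = i' + 1 := ⟨k - 1, by omega⟩
  have := h k (by omega) l (by omega)
  omega

theorem IsGT.ins {k : ℕ} {y : ℕ → ℕ → ℕ} (h : IsGT k y) (j : ℕ) : IsGT k (ins y j) := by
  induction k with
  | zero => intro i hi; omega
  | succ k ih =>
    have ih := ih (h.mono (by omega))
    intro i hi l hl
    rcases Nat.lt_or_ge i k with hik | hik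
    · exact ih i hik l hl
    obtain rfl : i = k := by omega
    have hc := ih.chamb
    have hy := h i hi l hl
    rcases Nat.lt_or_ge i j with hj | hj
    · simp only [_root_.ins]
      rw [sPos_zero y j i (by omega), sPos_zero y j (i+1) (by omega)]
      simpa using hy
    have hs := sPos_succ y j i hj
    have hge := nxt_ge y i (sPos y j i)
    have hcond := nxt_cond y i (sPos y j i)
    have hmin := nxt_min y i (sPos y j i)
    simp only [Chamb, _root_.ins] at hc ⊢
    rw [hs]
    generalize hN : nxt y i (sPos y j i) = N at *
    generalize hS : sPos y j i = S at *
    constructor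
    · by_cases h1 : N = l
      · subst h1; rw [if_pos rfl]; omega
      · rw [if_neg (by omega)]; omega
    · by_cases h1 : S = l + 1
      · subst h1
        rw [if_pos rfl]
        by_cases h2 : N = l + 1
        · rw [if_pos (by omega)]; omega
        · rw [if_neg (by omega)]
          have h3 := hmin (l+1) le_rfl (by omega)
          have h4 := hc l (by omega)
          rw [if_pos rfl, if_neg (by omega)] at h4
          omega
      · rw [if_neg h1]; split_ifs <;> omega

theorem local_bij (k : ℕ) : ∀ (z : ℕ → ℕ → ℕ), IsGT k z → ∀ r, r < k → 0 < z k r →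
    Chamb k (decr (z k) r) → ∃ z' j', j' < k ∧ IsGT k z' ∧ z' k = decr (z k) r ∧
    ∀ y j, IsGT k y → j < k →
      ((EqUp k (ins y j) z ∧ sPos y j k = r + 1) ↔ (EqUp k y z' ∧ j = j')) := by
  induction k with
  | zero => intro z _ r hr; omega
  | succ k ih =>
    intro z hz r hr hzr hch
    by_cases hex : ∃ m, m < r ∧ z (k+1) m < z k m
    · obtain ⟨m, hmr, hmz, hmax⟩ : ∃ m, m < r ∧ z (k+1) m < z k m ∧
          ∀ l, m < l → l < r → z k l ≤ z (k+1) l := by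
        classical
        obtain ⟨m0, hm0, hm0'⟩ := hex
        refine ⟨Nat.findGreatest (fun m => m < r ∧ z (k+1) m < z k m) r, ?_, ?_, ?_⟩
        · exact (Nat.findGreatest_spec (P := fun m => m < r ∧ z (k+1) m < z k m)
            (le_of_lt hm0) ⟨hm0, hm0'⟩).1
        · exact (Nat.findGreatest_spec (P := fun m => m < r ∧ z (k+1) m < z k m)
            (le_of_lt hm0) ⟨hm0, hm0'⟩).2
        · intro l hl hlr
          have := Nat.findGreatest_is_greatest hl (le_of_lt hlr)
          by_contra hc
          exact this ⟨hlr, by omega⟩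
      have hchk := (hz.mono (Nat.le_succ k)).chamb
      have hzk := hz k (by omega)
      obtain ⟨z'', j', hj', hz'', htop, hiff⟩ := ih z (hz.mono (by omega)) m (by omega) (by omega) (by
        intro l hl
        have h1 := hchk l hl
        simp only [decr]
        by_cases h2 : l + 1 = m
        · have := hzk l (by omega)
          rw [if_neg (by omega), if_pos h2, h2]
          rw [h2] at this
          omega
        · rw [if_neg h2]; split_ifs <;> omega)
      refine ⟨Function.update z'' (k+1) (decr (z (k+1)) r), j', by omega, ?_, by simp, ?_⟩
      · intro i hi l hl
        rcases Nat.lt_or_ge i k with hik | hik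
        · rw [Function.update_of_ne (by omega), Function.update_of_ne (by omega)]
          exact hz'' i hik l hl
        obtain rfl : i = k := by omega
        rw [Function.update_self, Function.update_of_ne (by omega), htop]
        have h1 := hzk l hl
        have h2 := hch l (by omega)
        simp only [decr] at h2 ⊢
        constructor
        · by_cases hlm : l = m
          · subst hlm; rw [if_neg (by omega), if_pos rfl]; omega
          · rw [if_neg hlm]; split_ifs <;> omega
        · by_cases hlr : l + 1 = r
          · rw [if_pos hlr] at h2 ⊢
            by_cases hlm : l = m
            · rw [if_pos hlm]; omega
            · rw [if_neg hlm]
              rw [if_neg (by omega)] at h2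
              have := hmax l (by omega) (by omega)
              omega
          · rw [if_neg hlr]; split_ifs <;> omega
      · intro y j hy hj
        have hyk := hy k (by omega)
        constructor
        · rintro ⟨heq, hs⟩
          rcases Nat.lt_or_ge j k with hjk | hjk
          · have hs1 := sPos_succ y j k (by omega)
            have hp := sPos_pos y j k hjk
            have hl := sPos_le y j k
            obtain ⟨q, hq⟩ : ∃ q, sPos y j k = q + 1 := ⟨sPos y j k - 1, by omega⟩
            have hnr : nxt y k (q+1) = r := by rw [hq] at hs1; omega
            have hqr : q + 1 ≤ r := hnr ▸ nxt_ge y k (q+1)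
            have e1 := heq k (by omega)
            have e2 := heq (k+1) (by omega)
            simp only [ins, hq, hs] at e1 e2
            have hqm : q = m := by
              by_contra hne
              rcases Nat.lt_or_ge q m with h | h
              · have h1 := nxt_min y k (q+1) m (by omega) (by omega)
                have e1 := e1 m (by omega)
                have e2 := e2 m (by omega)
                rw [if_neg (by omega)] at e1 e2
                omega
              · have h1 := hmax q (by omega) (by omega)
                have e1 := e1 q (by omega)
                have e2 := e2 q (by omega)
                rw [if_pos rfl] at e1
                rw [if_neg (by omega)] at e2
                have := hyk q (by omega)
                omega
            subst hqm
            have := (hiff y j (hy.mono (by omega)) hjk).1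
              ⟨fun i hi l hl => heq i (by omega) l hl, hq⟩
            refine ⟨?_, this.2⟩
            intro i hi l hl
            rcases Nat.lt_or_ge k i with hik | hik
            · obtain rfl : i = k + 1 := by omega
              have e2 := e2 l (by omega)
              rw [Function.update_self]
              simp only [decr]
              split_ifs at * <;> omega
            · rw [Function.update_of_ne (by omega)]
              exact this.1 i hik l hl
          · obtain rfl : j = k := by omega
            exfalso
            have hs1 := sPos_succ y j j le_rfl
            have hs0 := sPos_zero y j j le_rfl
            rw [hs0] at hs1
            have h1 := nxt_min y j 0 m (by omega) (by omega)
            have e1 := heq j (by omega) m (by omega)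
            have e2 := heq (j+1) (by omega) m (by omega)
            simp only [ins, hs0, hs] at e1 e2
            rw [if_neg (by omega)] at e1 e2
            omega
        · rintro ⟨heq, rfl⟩
          have heqk : EqUp k y z'' := by
            intro i hi l hl
            have := heq i (by omega) l hl
            rwa [Function.update_of_ne (by omega)] at this
          have htopy : ∀ l, l < k + 1 → y (k+1) l = decr (z (k+1)) r l := by
            intro l hl
            have := heq (k+1) le_rfl l hl
            rwa [Function.update_self] at this
          obtain ⟨h1, h2⟩ := (hiff y j (hy.mono (by omega)) hj').2 ⟨heqk, rfl⟩
          have hs1 := sPos_succ y j k (by omega)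
          have hyk' : ∀ l, l < k → y k l = decr (z k) m l := by
            intro l hl
            rw [heqk k le_rfl l hl, htop]
          have hn : nxt y k (m+1) = r := by
            apply nxt_eq
            · omega
            · by_cases hrk : k ≤ r
              · exact Or.inl hrk
              · right
                rw [htopy r (by omega), hyk' r (by omega)]
                simp only [decr, if_true]
                rw [if_neg (by omega)]
                have := hzk r (by omega)
                omega
            · intro l hl hlr
              refine ⟨by omega, ?_⟩
              rw [htopy l (by omega), hyk' l (by omega)]
              simp only [decr]
              rw [if_neg (by omega), if_neg (by omega)]
              exact hmax l (by omega) hlr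
          have hsr : sPos y j (k+1) = r + 1 := by rw [hs1, h2, hn]
          refine ⟨?_, hsr⟩
          intro i hi l hl
          rcases Nat.lt_or_ge k i with hik | hik
          · obtain rfl : i = k + 1 := by omega
            simp only [ins, hsr]
            rw [htopy l hl]
            simp only [decr]
            by_cases hlr : l = r
            · subst hlr; simp; omega
            · rw [if_neg hlr, if_neg (by omega)]; omega
          · exact h1 i hik l hl
    · push Not at hex
      have hzk := hz k (by omega)
      refine ⟨Function.update z (k+1) (decr (z (k+1)) r), k, by omega, ?_, by simp, ?_⟩
      · intro i hi l hl
        rcases Nat.lt_or_ge i k with hik | hik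
        · rw [Function.update_of_ne (by omega), Function.update_of_ne (by omega)]
          exact hz i hi l hl
        obtain rfl : i = k := by omega
        rw [Function.update_self, Function.update_of_ne (by omega)]
        have h1 := hzk l hl
        have h2 := hch l (by omega)
        simp only [decr] at h2 ⊢
        constructor
        · split_ifs <;> omega
        · by_cases hlr : l + 1 = r
          · rw [if_pos hlr] at h2 ⊢
            rw [if_neg (by omega)] at h2
            have := hex l (by omega)
            omega
          · rw [if_neg hlr]; omega
      · intro y j hy hj
        have hyk := hy k (by omega)
        constructor
        · rintro ⟨heq, hs⟩
          have hjk : j = k := by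
            by_contra hne
            have hs1 := sPos_succ y j k (by omega)
            have hp := sPos_pos y j k (by omega)
            have hl := sPos_le y j k
            obtain ⟨q, hq⟩ : ∃ q, sPos y j k = q + 1 := ⟨sPos y j k - 1, by omega⟩
            have hnr : nxt y k (q+1) = r := by rw [hq] at hs1; omega
            have hqr : q + 1 ≤ r := hnr ▸ nxt_ge y k (q+1)
            have e1 := heq k (by omega) q (by omega)
            have e2 := heq (k+1) (by omega) q (by omega)
            simp only [ins, hq, hs] at e1 e2
            rw [if_pos True.intro] at e1
            rw [if_neg (by omega)] at e2
            have := hyk q (by omega)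
            have := hex q (by omega)
            omega
          subst hjk
          refine ⟨?_, rfl⟩
          intro i hi l hl
          have e := heq i hi l hl
          simp only [ins] at e
          rcases Nat.lt_or_ge j i with hik | hik
          · obtain rfl : i = j + 1 := by omega
            rw [hs] at e
            rw [Function.update_self]
            simp only [decr]
            split_ifs at * <;> omega
          · rw [Function.update_of_ne (by omega)]
            rw [sPos_zero y j i hik, if_neg (by omega)] at e
            exact e
        · rintro ⟨heq, rfl⟩
          have htopy : ∀ l, l < j + 1 → y (j+1) l = decr (z (j+1)) r l := by
            intro l hl
            have := heq (j+1) le_rfl l hl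
            rwa [Function.update_self] at this
          have hyk' : ∀ i, i ≤ j → ∀ l, l < i → y i l = z i l := by
            intro i hi l hl
            have := heq i (by omega) l hl
            rwa [Function.update_of_ne (by omega)] at this
          have hs1 := sPos_succ y j j (by omega)
          rw [sPos_zero y j j le_rfl] at hs1
          have hn : nxt y j 0 = r := by
            apply nxt_eq
            · omega
            · by_cases hrk : j ≤ r
              · exact Or.inl hrk
              · right
                rw [htopy r (by omega), hyk' j le_rfl r (by omega)]
                simp only [decr, if_true]
                have := hzk r (by omega)
                omega
            · intro l hl hlr
              refine ⟨by omega, ?_⟩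
              rw [htopy l (by omega), hyk' j le_rfl l (by omega)]
              simp only [decr]
              rw [if_neg (by omega)]
              exact hex l hlr
          have hsr : sPos y j (j+1) = r + 1 := by rw [hs1, hn]
          refine ⟨?_, hsr⟩
          intro i hi l hl
          simp only [ins]
          rcases Nat.lt_or_ge j i with hik | hik
          · obtain rfl : i = j + 1 := by omega
            rw [htopy l hl, hsr]
            simp only [decr]
            by_cases hlr : l = r
            · subst hlr; simp; omega
            · rw [if_neg hlr, if_neg (by omega)]; omega
          · rw [sPos_zero y j i hik, if_neg (by omega), hyk' i hik l hl]; rfl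


/-- The condition for level `l` to move when row pointer is `i`. -/
def bCond (y : ℕ → ℕ → ℕ) (i l : ℕ) : Prop := i ≤ l ∨ y (i+1) l < y i l

open Classical in
/-- The row pointer, as a function of the level. -/
noncomputable def walkI (y : ℕ → ℕ → ℕ) (j : ℕ) : ℕ → ℕ
  | 0 => j
  | l+1 => if bCond y (walkI y j l) l then walkI y j l + 1 else walkI y j l

theorem walkI_mono (y : ℕ → ℕ → ℕ) (j : ℕ) : Monotone (walkI y j) := by
  apply monotone_nat_of_le_succ
  intro l
  rw [walkI]
  split_ifs <;> omega

theorem walkI_ge (y : ℕ → ℕ → ℕ) (j l : ℕ) : l ≤ walkI y j l := by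
  induction l with
  | zero => omega
  | succ l ih =>
    rw [walkI]
    split_ifs with h
    · omega
    · simp only [bCond] at h; omega

theorem walkI_stay (y : ℕ → ℕ → ℕ) (j i s : ℕ) (h : walkI y j s = i) (d : ℕ)
    (hd : s + d ≤ nxt y i s) : walkI y j (s + d) = i := by
  induction d with
  | zero => exact h
  | succ d ih =>
    have ih := ih (by omega)
    have := nxt_min y i s (s+d) (by omega) (by omega)
    rw [← add_assoc, walkI, ih, if_neg]
    simp only [bCond]; omega

theorem walkI_sPos (y : ℕ → ℕ → ℕ) (j d : ℕ) : walkI y j (sPos y j (j+d)) = j + d := by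
  induction d with
  | zero => rw [Nat.add_zero, sPos_zero y j j le_rfl, walkI]
  | succ d ih =>
    rw [← add_assoc, sPos_succ y j (j+d) (by omega)]
    have hge := nxt_ge y (j+d) (sPos y j (j+d))
    have := walkI_stay y j (j+d) _ ih (nxt y (j+d) (sPos y j (j+d)) - sPos y j (j+d)) (by omega)
    rw [show sPos y j (j+d) + (nxt y (j+d) (sPos y j (j+d)) - sPos y j (j+d))
      = nxt y (j+d) (sPos y j (j+d)) by omega] at this
    rw [walkI, this, if_pos]
    exact nxt_cond y (j+d) _

theorem sPos_iff (y : ℕ → ℕ → ℕ) (j i l : ℕ) :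
    sPos y j (i+1) = l + 1 ↔ walkI y j l = i ∧ bCond y i l := by
  have hmono := walkI_mono y j
  constructor
  · intro h
    have hij : j ≤ i := by
      by_contra hc
      rw [sPos_zero y j (i+1) (by omega)] at h
      omega
    obtain ⟨d, rfl⟩ : ∃ d, i = j + d := ⟨i - j, by omega⟩
    rw [sPos_succ y j _ hij] at h
    have hl : nxt y (j+d) (sPos y j (j+d)) = l := by omega
    have hge := nxt_ge y (j+d) (sPos y j (j+d))
    have hst := walkI_stay y j (j+d) _ (walkI_sPos y j d) (l - sPos y j (j+d)) (by omega)
    rw [show sPos y j (j+d) + (l - sPos y j (j+d)) = l by omega] at hst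
    refine ⟨hst, ?_⟩
    have := nxt_cond y (j+d) (sPos y j (j+d))
    rwa [hl] at this
  · rintro ⟨h1, h2⟩
    have hij : j ≤ i := by
      have := hmono (Nat.zero_le l)
      rw [walkI] at this
      omega
    obtain ⟨d, rfl⟩ : ∃ d, i = j + d := ⟨i - j, by omega⟩
    have hl1 : walkI y j (l+1) = j + d + 1 := by
      rw [walkI, h1, if_pos h2]
    have hw := walkI_sPos y j d
    have hge : sPos y j (j+d) ≤ l := by
      by_contra hc
      have := hmono (show l + 1 ≤ sPos y j (j+d) by omega)
      omega
    have hw' := walkI_sPos y j (d+1)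
    rw [← add_assoc, sPos_succ y j _ hij] at hw'
    rw [sPos_succ y j _ hij]
    have hle : l ≤ nxt y (j+d) (sPos y j (j+d)) := by
      by_contra hc
      have := hmono (show nxt y (j+d) (sPos y j (j+d)) + 1 ≤ l by omega)
      omega
    have : ¬ l < nxt y (j+d) (sPos y j (j+d)) := by
      intro hc
      have := nxt_min y _ _ l hge hc
      simp only [bCond] at h2
      omega
    omega


/-- The array of a word. -/
noncomputable def arr (u : ℕ → ℕ) : ℕ → ℕ → ℕ → ℕ
  | 0 => fun _ _ => 0
  | n+1 => ins (arr u n) (u n)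

theorem arr_GT (u : ℕ → ℕ) (n k : ℕ) : IsGT k (arr u n) := by
  induction n with
  | zero => intro i _ l _; simp [arr]
  | succ n ih => exact ih.ins _

theorem arr_congr (u v : ℕ → ℕ) (n : ℕ) (h : ∀ m, m < n → u m = v m) : arr u n = arr v n := by
  induction n with
  | zero => rfl
  | succ n ih => rw [arr, arr, ih (fun m hm => h m (by omega)), h n (by omega)]

theorem maxOp_eq (x y : ℕ → ℤ) (n : ℕ) : maxOp y x n = x n + y n - minOp x y n := by
  apply le_antisymm
  · apply Finset.sup'_le
    intro m hm
    have : minOp x y n ≤ x m + y n - y m :=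
      Finset.inf'_le (fun m => x m + y n - y m) hm
    omega
  · have : x n + y n - maxOp y x n ≤ minOp x y n := by
      apply Finset.le_inf'
      intro m hm
      have : y m + x n - x m ≤ maxOp y x n :=
        Finset.le_sup' (fun m => y m + x n - x m) hm
      omega
    omega

theorem minOp_zero (x y : ℕ → ℤ) : minOp x y 0 = x 0 := by
  simp [minOp]

theorem minOp_le (x y : ℕ → ℤ) (n : ℕ) : minOp x y n ≤ x n := by
  have : minOp x y n ≤ x n + y n - y n :=
    Finset.inf'_le (fun m => x m + y n - y m) (Finset.self_mem_range_succ n)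
  omega

theorem minOp_succ (x y : ℕ → ℤ) (n : ℕ) :
    minOp x y (n+1) = min (minOp x y n + (y (n+1) - y n)) (x (n+1)) := by
  apply le_antisymm
  · apply le_min
    · have : minOp x y (n+1) - (y (n+1) - y n) ≤ minOp x y n := by
        apply Finset.le_inf'
        intro m hm
        have : minOp x y (n+1) ≤ x m + y (n+1) - y m :=
          Finset.inf'_le (fun m => x m + y (n+1) - y m)
            (Finset.mem_range.2 (by have := Finset.mem_range.1 hm; omega))
        omega
      omega
    · exact minOp_le x y (n+1)
  · apply Finset.le_inf'
    intro m hm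
    have hm := Finset.mem_range.1 hm
    rcases Nat.lt_or_ge m (n+1) with h | h
    · have : minOp x y n ≤ x m + y n - y m :=
        Finset.inf'_le (fun m => x m + y n - y m) (Finset.mem_range.2 h)
      have := min_le_left (minOp x y n + (y (n+1) - y n)) (x (n+1))
      omega
    · obtain rfl : m = n + 1 := by omega
      have := min_le_right (minOp x y n + (y (n+1) - y n)) (x (n+1))
      omega

theorem Dseq_anti (x : ℕ → ℕ → ℤ) (i n : ℕ) : Dseq x (i+1) n ≤ Dseq x i n := minOp_le _ _ _

theorem Tseq_eq (x : ℕ → ℕ → ℤ) (i n : ℕ) :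
    Tseq x i n = Dseq x i n + x (i+1) n - Dseq x (i+1) n := maxOp_eq _ _ _

open Classical in
theorem Dseq_step (x : ℕ → ℕ → ℤ) (c n : ℕ)
    (h : ∀ i, x i (n+1) = x i n + if i = c then 1 else 0) (i : ℕ) :
    Dseq x i (n+1) = Dseq x i n +
      if i = c ∧ (c = 0 ∨ Dseq x c n < Dseq x (c-1) n) then 1 else 0 := by
  induction i with
  | zero =>
    rw [Dseq, h 0]
    by_cases hc : c = 0
    · subst hc; simp
    · rw [if_neg (by omega), if_neg (by omega)]
  | succ i ih =>
    have ha := Dseq_anti x i n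
    have hs : Dseq x (i+1) (n+1) = min (Dseq x (i+1) n + (x (i+1) (n+1) - x (i+1) n))
      (Dseq x i (n+1)) := minOp_succ _ _ _
    rw [hs, ih, h (i+1)]
    by_cases hc : i + 1 = c
    · subst hc
      simp only [true_and, Nat.add_sub_cancel, if_true]
      rw [if_neg (by omega)]
      by_cases hlt : Dseq x (i+1) n < Dseq x i n
      · rw [if_pos (Or.inr hlt), min_eq_left (by omega)]; omega
      · rw [if_neg (by omega), min_eq_right (by omega)]; omega
    · rw [if_neg hc, if_neg (show ¬(i + 1 = c ∧ (c = 0 ∨ Dseq x c n < Dseq x (c-1) n)) from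
        fun h => hc h.1), min_eq_left]
      · omega
      · split_ifs <;> omega

open Classical in
theorem Tseq_step (x : ℕ → ℕ → ℤ) (c n : ℕ)
    (h : ∀ i, x i (n+1) = x i n + if i = c then 1 else 0) (i : ℕ) :
    Tseq x i (n+1) = Tseq x i n +
      if i = (if c = 0 ∨ Dseq x c n < Dseq x (c-1) n then c else c - 1) then 1 else 0 := by
  rw [Tseq_eq, Tseq_eq, Dseq_step x c n h, Dseq_step x c n h, h (i+1)]
  by_cases hb : c = 0 ∨ Dseq x c n < Dseq x (c-1) n
  · simp only [hb, and_true, if_true]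
    omega
  · simp only [hb, and_false, if_false]
    have : c ≠ 0 := by tauto
    split_ifs <;> omega

theorem level_zero (x : ℕ → ℕ → ℤ) (h : ∀ i, x i 0 = 0) (l i : ℕ) :
    (Tseq^[l] x) i 0 = 0 ∧ Dseq (Tseq^[l] x) i 0 = 0 := by
  have key : ∀ x : ℕ → ℕ → ℤ, (∀ i, x i 0 = 0) → ∀ i, Dseq x i 0 = 0 := by
    intro x h i
    induction i with
    | zero => exact h 0
    | succ i ih => rw [Dseq, minOp_zero, ih]
  induction l generalizing x i with
  | zero => exact ⟨h i, key x h i⟩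
  | succ l ih =>
    rw [Function.iterate_succ_apply]
    apply ih
    intro i
    rw [Tseq_eq, key x h, key x h, h]; rfl

/-- The counting path of a word. -/
def cnt (u : ℕ → ℕ) (i n : ℕ) : ℤ := ((((Finset.range n).filter (fun m => u m = i))).card : ℤ)

theorem cnt_step (u : ℕ → ℕ) (i n : ℕ) :
    cnt u i (n+1) = cnt u i n + if i = u n then 1 else 0 := by
  simp only [cnt, Finset.range_add_one, Finset.filter_insert]
  by_cases h : u n = i
  · rw [if_pos h, if_pos h.symm, Finset.card_insert_of_notMem (by simp)]; push_cast; rfl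
  · rw [if_neg h, if_neg (Ne.symm h)]; simp

theorem Dseq_eq_arr (u : ℕ → ℕ) (n : ℕ) : ∀ l c,
    Dseq (Tseq^[l] (cnt u)) c n = (arr u n (l+c+1) l : ℤ) := by
  induction n with
  | zero =>
    intro l c
    rw [(level_zero (cnt u) (fun i => by simp [cnt]) l c).2]
    simp [arr]
  | succ n ih =>
    set y := arr u n with hy
    have hx : ∀ l i, (Tseq^[l] (cnt u)) i (n+1) = (Tseq^[l] (cnt u)) i n +
        if i = walkI y (u n) l - l then 1 else 0 := by
      intro l
      induction l with
      | zero => intro i; exact cnt_step u i n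
      | succ l ihl =>
        intro i
        rw [Function.iterate_succ_apply', Tseq_step _ _ n ihl]
        congr 2
        rw [ih, ih]
        have hge := walkI_ge y (u n) l
        rw [walkI]
        generalize hI : walkI y (u n) l = I at *
        have hb : (I - l = 0 ∨ ((y (l + (I - l) + 1) l : ℕ) : ℤ) < ((y (l + (I - l - 1) + 1) l : ℕ) : ℤ))
            ↔ bCond y I l := by
          simp only [bCond]
          rw [show l + (I - l) + 1 = I + 1 by omega]
          by_cases hIl : I ≤ l
          · simp only [hIl, true_or, iff_true]; left; omega
          · rw [show l + (I - l - 1) + 1 = I by omega]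
            simp only [hIl, false_or]
            rw [Nat.cast_lt]
            constructor
            · rintro (h | h)
              · omega
              · exact h
            · exact Or.inr
        apply propext
        by_cases hbb : bCond y I l
        · rw [if_pos (hb.2 hbb), if_pos hbb]
          omega
        · rw [if_neg (fun h => hbb (hb.1 h)), if_neg hbb]
          omega
    intro l c
    rw [Dseq_step _ _ n (hx l), ih, ih, ih]
    simp only [arr, ins]
    push_cast
    congr 1
    have hge := walkI_ge y (u n) l
    have := sPos_iff y (u n) (l+c) l
    apply if_congr _ rfl rfl
    rw [← hy, this]
    generalize hI : walkI y (u n) l = I at *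
    constructor
    · rintro ⟨h1, h2⟩
      have hI' : I = l + c := by omega
      refine ⟨hI', ?_⟩
      subst hI'
      simp only [bCond]
      by_cases hc : c = 0
      · left; omega
      · right
        rcases h2 with h2 | h2
        · omega
        · rw [show l + (l + c - l) + 1 = l + c + 1 by omega,
            show l + (l + c - l - 1) + 1 = l + c by omega] at h2
          exact_mod_cast h2
    · rintro ⟨rfl, h2⟩
      refine ⟨by omega, ?_⟩
      by_cases hc : c = 0
      · left; omega
      · right
        simp only [bCond] at h2
        rw [show l + (l + c - l) + 1 = l + c + 1 by omega,
            show l + (l + c - l - 1) + 1 = l + c by omega]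
        rcases h2 with h2 | h2
        · omega
        · exact_mod_cast h2

theorem G_eq (k : ℕ) : ∀ (x : ℕ → ℕ → ℤ) (l : ℕ), l < k →
    G k x l = Dseq (Tseq^[l] x) (k - 1 - l) := by
  induction k with
  | zero => intro x l hl; omega
  | succ k ih =>
    intro x l hl
    cases k with
    | zero =>
      obtain rfl : l = 0 := by omega
      rfl
    | succ k =>
      cases l with
      | zero => rfl
      | succ l =>
        have := ih (Tseq x) l (by omega)
        rw [Function.iterate_succ_apply]
        rw [show k + 1 + 1 - 1 - (l + 1) = k + 1 - 1 - l by omega, ← this]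
        rfl

theorem G_arr (k : ℕ) (u : ℕ → ℕ) (l n : ℕ) (hl : l < k) :
    G k (cnt u) l n = (arr u n k l : ℤ) := by
  rw [G_eq k _ l hl, Dseq_eq_arr, show l + (k - 1 - l) + 1 = k by omega]


open Classical in
/-- Recursive count of chamber paths. -/
noncomputable def chN (k : ℕ) : ℕ → (ℕ → ℕ) → ℕ
  | 0, v => if ∀ i, i < k → v i = 0 then 1 else 0
  | n+1, v => ∑ r ∈ Finset.range k,
      if 0 < v r ∧ Chamb k (decr v r) then chN k n (decr v r) else 0

/-- The set of chamber paths. -/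
def pathSet (k n : ℕ) (x : ℕ → ℕ) : Set (ℕ → ℕ → ℤ) :=
  {g : ℕ → ℕ → ℤ |
    (∀ i m, k ≤ i ∨ n < m → g i m = 0) ∧
    (∀ i, i < k → g i 0 = 0) ∧
    (∀ m, 1 ≤ m → m ≤ n →
      ∃ j, j < k ∧ g j m = g j (m-1) + 1 ∧ ∀ i, i < k → i ≠ j → g i m = g i (m-1)) ∧
    (∀ m ≤ n, ∀ i, i + 1 < k → g i m ≤ g (i+1) m) ∧
    (∀ i, i < k → g i n = (x i : ℤ))}

theorem pathSet_nonneg {k n : ℕ} {x : ℕ → ℕ} {g : ℕ → ℕ → ℤ} (hg : g ∈ pathSet k n x)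
    (m : ℕ) (hm : m ≤ n) (i : ℕ) (hi : i < k) : 0 ≤ g i m := by
  obtain ⟨_, h0, hs, _, _⟩ := hg
  induction m with
  | zero => rw [h0 i hi]
  | succ m ih =>
    have ih := ih (by omega)
    obtain ⟨j, hj, h1, h2⟩ := hs (m+1) (by omega) hm
    simp only [Nat.add_sub_cancel] at h1 h2
    by_cases hij : i = j
    · subst hij; omega
    · rw [h2 i hi hij]; exact ih

theorem pathSet_count (k n : ℕ) : ∀ v, Chamb k v →
    ∃ F : Finset (ℕ → ℕ → ℤ), (F : Set (ℕ → ℕ → ℤ)) = pathSet k n v ∧ F.card = chN k n v := by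
  classical
  induction n with
  | zero =>
    intro v hv
    by_cases h : ∀ i, i < k → v i = 0
    · refine ⟨{fun _ _ => 0}, ?_, ?_⟩
      · ext g
        simp only [Finset.coe_singleton, Set.mem_singleton_iff, pathSet, Set.mem_ofPred_eq]
        constructor
        · rintro rfl
          refine ⟨fun _ _ _ => rfl, fun _ _ => rfl, fun m h1 h2 => by omega, fun _ _ _ _ => le_rfl, ?_⟩
          intro i hi
          rw [h i hi]; rfl
        · rintro ⟨h1, h2, _⟩
          funext i m
          by_cases hi : k ≤ i ∨ 0 < m
          · exact h1 i m hi
          · obtain rfl : m = 0 := by omega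
            exact h2 i (by omega)
      · simp only [chN, Finset.card_singleton]
        rw [if_pos h]
    · refine ⟨∅, ?_, ?_⟩
      · symm
        rw [Finset.coe_empty, Set.eq_empty_iff_forall_notMem]
        rintro g ⟨_, h2, _, _, h5⟩
        apply h
        intro i hi
        have := h2 i hi
        rw [h5 i hi] at this
        exact_mod_cast this
      · simp only [chN, Finset.card_empty]
        rw [if_neg h]
  | succ n ih =>
    intro v hv
    have ih' : ∀ r, ∃ F : Finset (ℕ → ℕ → ℤ), (0 < v r ∧ Chamb k (decr v r)) →
        ((F : Set (ℕ → ℕ → ℤ)) = pathSet k n (decr v r) ∧ F.card = chN k n (decr v r)) := by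
      intro r
      by_cases h : 0 < v r ∧ Chamb k (decr v r)
      · obtain ⟨F, hF⟩ := ih _ h.2
        exact ⟨F, fun _ => hF⟩
      · exact ⟨∅, fun h' => absurd h' h⟩
    choose F hF using ih'
    let ext : (ℕ → ℕ → ℤ) → (ℕ → ℕ → ℤ) :=
      fun g i m => if m = n + 1 ∧ i < k then (v i : ℤ) else g i m
    have hext : ∀ g i m, m ≤ n → ext g i m = g i m := by
      intro g i m hm
      simp only [ext]
      rw [if_neg (by omega)]
    refine ⟨((Finset.range k).filter (fun r => 0 < v r ∧ Chamb k (decr v r))).biUnion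
      (fun r => (F r).image ext), ?_, ?_⟩
    · apply Set.ext
      intro g
      simp only [Finset.coe_biUnion, Finset.coe_filter, Finset.mem_range, Set.mem_ofPred_eq,
        Finset.coe_image, Set.mem_iUnion, Set.mem_image, exists_prop]
      constructor
      · rintro ⟨r, ⟨hr, hc⟩, g', hg', rfl⟩
        rw [(hF r hc).1] at hg'
        obtain ⟨h1, h2, h3, h4, h5⟩ := hg'
        refine ⟨?_, ?_, ?_, ?_, ?_⟩
        · intro i m him
          simp only [ext]
          rw [if_neg (by omega)]
          exact h1 i m (by omega)
        · intro i hi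
          rw [hext _ _ _ (by omega)]
          exact h2 i hi
        · intro m hm1 hm2
          rcases Nat.lt_or_ge n m with hm | hm
          · obtain rfl : m = n + 1 := by omega
            refine ⟨r, hr, ?_, ?_⟩
            · rw [Nat.add_sub_cancel, hext _ _ _ le_rfl, h5 r hr]
              simp only [ext, decr, if_true]
              rw [if_pos ⟨trivial, hr⟩]
              have := hc.1
              omega
            · intro i hi hir
              rw [Nat.add_sub_cancel, hext _ _ _ le_rfl, h5 i hi]
              simp only [ext, decr]
              rw [if_pos ⟨trivial, hi⟩, if_neg hir]
          · obtain ⟨j, hj, e1, e2⟩ := h3 m hm1 hm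
            refine ⟨j, hj, ?_, ?_⟩
            · rw [hext _ _ _ hm, hext _ _ _ (by omega), e1]
            · intro i hi hij
              rw [hext _ _ _ hm, hext _ _ _ (by omega), e2 i hi hij]
        · intro m hm i hi
          rcases Nat.lt_or_ge n m with hm' | hm'
          · obtain rfl : m = n + 1 := by omega
            simp only [ext]
            rw [if_pos ⟨trivial, by omega⟩, if_pos ⟨trivial, by omega⟩]
            exact_mod_cast hv i hi
          · rw [hext _ _ _ hm', hext _ _ _ hm']
            exact h4 m hm' i hi
        · intro i hi
          simp only [ext]
          rw [if_pos ⟨trivial, hi⟩]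
      · intro hg
        have hnn := pathSet_nonneg hg n (by omega)
        obtain ⟨h1, h2, h3, h4, h5⟩ := hg
        obtain ⟨j, hj, e1, e2⟩ := h3 (n+1) (by omega) le_rfl
        rw [Nat.add_sub_cancel] at e1 e2
        rw [h5 j hj] at e1
        have hjn := hnn j hj
        have hvj : 0 < v j := by omega
        have hcol : ∀ i, i < k → g i n = (decr v j i : ℤ) := by
          intro i hi
          simp only [decr]
          by_cases hij : i = j
          · subst hij; rw [if_pos rfl]; omega
          · rw [if_neg hij, ← e2 i hi hij, h5 i hi]
        have hch : Chamb k (decr v j) := by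
          intro l hl
          have := h4 n (by omega) l hl
          rw [hcol l (by omega), hcol (l+1) hl] at this
          exact_mod_cast this
        refine ⟨j, ⟨hj, hvj, hch⟩, fun i m => if m ≤ n then g i m else 0, ?_, ?_⟩
        · rw [(hF j ⟨hvj, hch⟩).1]
          refine ⟨?_, ?_, ?_, ?_, ?_⟩
          · intro i m him
            by_cases hm : m ≤ n
            · simp only [hm, if_true]; exact h1 i m (by omega)
            · simp only [hm, if_false]
          · intro i hi; simpa using h2 i hi
          · intro m hm1 hm2
            obtain ⟨j', hj', f1, f2⟩ := h3 m hm1 (by omega)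
            refine ⟨j', hj', ?_, ?_⟩
            · beta_reduce
              rw [if_pos hm2, if_pos (by omega), f1]
            · intro i hi hij
              beta_reduce
              rw [if_pos hm2, if_pos (by omega), f2 i hi hij]
          · intro m hm i hi
            beta_reduce
            rw [if_pos hm, if_pos hm]
            exact h4 m (by omega) i hi
          · intro i hi
            beta_reduce
            rw [if_pos le_rfl]
            exact hcol i hi
        · funext i m
          simp only [ext]
          by_cases h : m = n + 1 ∧ i < k
          · rw [if_pos h, h.1, h5 i h.2]
          · rw [if_neg h]
            by_cases hm : m ≤ n
            · rw [if_pos hm]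
            · rw [if_neg hm, h1 i m (by omega)]
    · rw [Finset.card_biUnion, chN, Finset.sum_filter]
      · apply Finset.sum_congr rfl
        intro r _
        by_cases hc : 0 < v r ∧ Chamb k (decr v r)
        · rw [if_pos hc, if_pos hc, Finset.card_image_of_injOn, (hF r hc).2]
          intro g hg g' hg' he
          rw [(hF r hc).1] at hg hg'
          funext i m
          rcases Nat.lt_or_ge n m with hm | hm
          · rw [hg.1 i m (Or.inr hm), hg'.1 i m (Or.inr hm)]
          · have := congrFun (congrFun he i) m
            rwa [hext _ _ _ hm, hext _ _ _ hm] at this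
        · rw [if_neg hc, if_neg hc]
      · intro r hr r' hr' hne
        simp only [Finset.mem_coe, Finset.mem_filter, Finset.mem_range] at hr hr'
        change Disjoint _ _
        rw [Finset.disjoint_left]
        intro g hg hg'
        simp only [Finset.mem_image] at hg hg'
        obtain ⟨g1, hg1, rfl⟩ := hg
        obtain ⟨g2, hg2, he⟩ := hg'
        have hg1 : g1 ∈ pathSet k n (decr v r) := by rw [← (hF r hr.2).1]; exact hg1
        have hg2 : g2 ∈ pathSet k n (decr v r') := by rw [← (hF r' hr'.2).1]; exact hg2
        have := congrFun (congrFun he r) n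
        rw [hext _ _ _ le_rfl, hext _ _ _ le_rfl, hg1.2.2.2.2 r hr.1, hg2.2.2.2.2 r hr.1] at this
        simp only [decr, if_true] at this
        rw [if_neg hne] at this
        have := hr.2.1
        omega

theorem numChamberPaths_eq (k n : ℕ) (v : ℕ → ℕ) (hv : Chamb k v) :
    numChamberPaths k n v = chN k n v := by
  obtain ⟨F, h1, h2⟩ := pathSet_count k n v hv
  have : numChamberPaths k n v = Set.ncard (pathSet k n v) := rfl
  rw [this, ← h1, Set.ncard_coe_finset, h2]


/-- Row sums. -/
def rSum (z : ℕ → ℕ → ℕ) (i : ℕ) : ℕ := ∑ l ∈ Finset.range i, z i l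

theorem IsGT.rSum_le {k : ℕ} {z : ℕ → ℕ → ℕ} (h : IsGT k z) (i : ℕ) (hi : i < k) :
    rSum z i ≤ rSum z (i+1) := by
  unfold rSum
  rw [Finset.sum_range_succ']
  have : ∑ l ∈ Finset.range i, z i l ≤ ∑ l ∈ Finset.range i, z (i+1) (l+1) :=
    Finset.sum_le_sum (fun l hl => (h i hi l (Finset.mem_range.1 hl)).2)
  omega

theorem rSum_ins (y : ℕ → ℕ → ℕ) (j i : ℕ) :
    rSum (ins y j) i = rSum y i + if j < i then 1 else 0 := by
  unfold rSum
  simp only [ins, Finset.sum_add_distrib]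
  congr 1
  by_cases h : j < i
  · have h1 := sPos_pos y j i h
    have h2 := sPos_le y j i
    rw [if_pos h, Finset.sum_eq_single (sPos y j i - 1)]
    · rw [if_pos (by omega)]
    · intro b _ hb
      rw [if_neg (by omega)]
    · intro hb
      rw [Finset.mem_range] at hb
      omega
  · rw [if_neg h, sPos_zero y j i (by omega)]
    apply Finset.sum_eq_zero
    intro l _
    rw [if_neg (by omega)]

theorem rSum_congr {k : ℕ} {y z : ℕ → ℕ → ℕ} (h : EqUp k y z) (i : ℕ) (hi : i ≤ k) :
    rSum y i = rSum z i :=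
  Finset.sum_congr rfl (fun l hl => h i hi l (Finset.mem_range.1 hl))

theorem IsGT.up {k : ℕ} {z : ℕ → ℕ → ℕ} (h : IsGT k z) (i d l : ℕ) (hi : i + d ≤ k) (hl : l < i) :
    z i l ≤ z (i+d) (l+d) := by
  induction d with
  | zero => exact le_rfl
  | succ d ih =>
    have := ih (by omega)
    have := (h (i+d) (by omega) (l+d) (by omega)).2
    rw [← add_assoc, ← add_assoc]
    omega

/-- The array of shapes of a tableau. -/
def zT (lam : ℕ → ℕ) (T : ℕ → ℕ → ℕ) : ℕ → ℕ → ℕ := fun i l =>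
  ((Finset.range (lam (i-1-l))).filter (fun c => T (i-1-l) c < i)).card

theorem lt_card_filter_iff (L c : ℕ) (hc : c < L) (P : ℕ → Prop) [DecidablePred P]
    (hP : ∀ a b, a ≤ b → b < L → P b → P a) :
    c < ((Finset.range L).filter P).card ↔ P c := by
  constructor
  · intro h
    by_contra hn
    have : (Finset.range L).filter P ⊆ Finset.range c := by
      intro a ha
      simp only [Finset.mem_filter, Finset.mem_range] at ha ⊢
      by_contra hac
      exact hn (hP c a (by omega) ha.1 ha.2)
    have := Finset.card_le_card this
    rw [Finset.card_range] at this
    omega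
  · intro h
    have : Finset.range (c+1) ⊆ (Finset.range L).filter P := by
      intro a ha
      simp only [Finset.mem_filter, Finset.mem_range] at ha ⊢
      exact ⟨by omega, hP a c (by omega) hc h⟩
    have := Finset.card_le_card this
    rw [Finset.card_range] at this
    omega

theorem revPart_anti {k : ℕ} {x : ℕ → ℕ} (hx : Chamb k x) (r : ℕ) :
    revPart k x (r+1) ≤ revPart k x r := by
  unfold revPart
  split_ifs with h1 h2
  · have := hx (k - 1 - (r+1)) (by omega)
    rwa [show k - 1 - (r+1) + 1 = k - 1 - r by omega] at this
  · omega
  · omega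
  · omega

theorem revPart_lt {k : ℕ} {x : ℕ → ℕ} {r c : ℕ} (h : c < revPart k x r) : r < k := by
  unfold revPart at h
  split_ifs at h with h1
  · exact h1
  · omega

section tab
variable {k : ℕ} {x : ℕ → ℕ} {T : ℕ → ℕ → ℕ}

theorem ssyt_ge (hx : Chamb k x) (hT : IsSSYT k (revPart k x) T) (r c : ℕ)
    (h : c < revPart k x r) : r ≤ T r c := by
  induction r with
  | zero => omega
  | succ r ih =>
    have := ih (lt_of_lt_of_le h (revPart_anti hx r))
    have := hT.2.2.2 r (r+1) c (by omega) h
    omega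

theorem zT_GT (hx : Chamb k x) (hT : IsSSYT k (revPart k x) T) : IsGT k (zT (revPart k x) T) := by
  intro i hi l hl
  simp only [zT]
  constructor
  · obtain ⟨r, hr⟩ : ∃ r, i - 1 - l = r := ⟨_, rfl⟩
    rw [hr, show i + 1 - 1 - l = r + 1 by omega]
    apply Finset.card_le_card
    intro c hc
    simp only [Finset.mem_filter, Finset.mem_range] at hc ⊢
    have := hT.2.2.2 r (r+1) c (by omega) hc.1
    exact ⟨lt_of_lt_of_le hc.1 (revPart_anti hx r), by omega⟩
  · rw [show i + 1 - 1 - (l + 1) = i - 1 - l by omega]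
    apply Finset.card_le_card
    intro c hc
    simp only [Finset.mem_filter, Finset.mem_range] at hc ⊢
    exact ⟨hc.1, by omega⟩

theorem zT_top (hT : IsSSYT k (revPart k x) T) (l : ℕ) (hl : l < k) :
    zT (revPart k x) T k l = x l := by
  simp only [zT]
  rw [Finset.filter_true_of_mem]
  · rw [Finset.card_range, revPart, if_pos (by omega), show k - 1 - (k - 1 - l) = l by omega]
  · intro c hc
    exact hT.1 _ _ (Finset.mem_range.1 hc)

theorem zT_iff (hT : IsSSYT k (revPart k x) T) (r c i : ℕ)
    (hc : c < revPart k x r) (hr : r < i) :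
    c < zT (revPart k x) T i (i-1-r) ↔ T r c < i := by
  simp only [zT]
  rw [show i - 1 - (i - 1 - r) = r by omega]
  apply lt_card_filter_iff _ _ hc
  intro a b hab hb h
  exact lt_of_le_of_lt (hT.2.2.1 r a b hab hb) h

theorem zT_inj (hx : Chamb k x) {T' : ℕ → ℕ → ℕ} (hT : IsSSYT k (revPart k x) T)
    (hT' : IsSSYT k (revPart k x) T')
    (h : EqUp k (zT (revPart k x) T) (zT (revPart k x) T')) : T = T' := by
  have key : ∀ r c, c < revPart k x r → ∀ i, i ≤ k → (T r c < i ↔ T' r c < i) := by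
    intro r c hc i hi
    by_cases hr : r < i
    · rw [← zT_iff hT r c i hc hr, ← zT_iff hT' r c i hc hr, h i hi (i-1-r) (by omega)]
    · have := ssyt_ge hx hT r c hc
      have := ssyt_ge hx hT' r c hc
      omega
  funext r c
  by_cases hc : c < revPart k x r
  · have h1 := hT.1 r c hc
    have h2 := hT'.1 r c hc
    have h3 := key r c hc (T r c + 1) (by omega)
    have h4 := key r c hc (T' r c + 1) (by omega)
    omega
  · rw [hT.2.1 r c hc, hT'.2.1 r c hc]

theorem zT_surj (hx : Chamb k x) {z : ℕ → ℕ → ℕ} (hz : IsGT k z) (htop : ∀ l, l < k → z k l = x l) :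
    ∃ T, IsSSYT k (revPart k x) T ∧ EqUp k (zT (revPart k x) T) z := by
  classical
  have hex : ∀ r c, ∃ i, r ≤ i ∧ (k ≤ i + 1 ∨ c < z (i+1) (i-r)) := fun r c =>
    ⟨max r k, le_max_left _ _, Or.inl (by have := le_max_right r k; omega)⟩
  let T : ℕ → ℕ → ℕ := fun r c => if c < revPart k x r then Nat.find (hex r c) else 0
  have hlam : ∀ r, r < k → revPart k x r = z k (k-1-r) := by
    intro r hr
    rw [revPart, if_pos hr, htop _ (by omega)]
  have key : ∀ r c i, c < revPart k x r → i ≤ k → (T r c < i ↔ r < i ∧ c < z i (i-1-r)) := by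
    intro r c i hc hi
    have hrk := revPart_lt hc
    simp only [T]
    rw [if_pos hc, Nat.find_lt_iff]
    constructor
    · rintro ⟨m, hm, h1, h2⟩
      refine ⟨by omega, ?_⟩
      rcases h2 with h2 | h2
      · rw [show i = k by omega, ← hlam r hrk]
        exact hc
      · have := hz.up (m+1) (i - (m+1)) (m-r) (by omega) (by omega)
        rw [show m + 1 + (i - (m+1)) = i by omega,
          show m - r + (i - (m+1)) = i - 1 - r by omega] at this
        omega
    · rintro ⟨h1, h2⟩
      refine ⟨i - 1, by omega, by omega, Or.inr ?_⟩
      rw [show i - 1 + 1 = i by omega]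
      exact h2
  have hTk : ∀ r c, c < revPart k x r → T r c < k := by
    intro r c hc
    have hrk := revPart_lt hc
    rw [key r c k hc le_rfl, ← hlam r hrk]
    exact ⟨hrk, hc⟩
  have hanti := antitone_nat_of_succ_le (revPart_anti hx)
  have hcol : ∀ r c, c < revPart k x (r+1) → T r c < T (r+1) c := by
    intro r c hc
    have hc' : c < revPart k x r := lt_of_lt_of_le hc (revPart_anti hx r)
    have h1 := hTk _ _ hc
    have h2 := (key (r+1) c (T (r+1) c + 1) hc (by omega)).1 (by omega)
    rw [key r c _ hc' (by omega)]
    refine ⟨by omega, ?_⟩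
    have h3 := (hz (T (r+1) c) h1 (T (r+1) c - 1 - r) (by omega)).1
    rw [show T (r+1) c + 1 - 1 - (r+1) = T (r+1) c - 1 - r by omega] at h2
    omega
  refine ⟨T, ⟨hTk, ?_, ?_, ?_⟩, ?_⟩
  · intro r c hc
    simp only [T]; rw [if_neg hc]
  · intro r c c' hcc hc'
    have h1 := hTk _ _ hc'
    have h2 := (key r c' (T r c' + 1) hc' (by omega)).1 (by omega)
    have h3 := (key r c (T r c' + 1) (by omega) (by omega)).2 ⟨h2.1, by omega⟩
    omega
  · intro r r' c hr hc
    obtain ⟨d, rfl⟩ : ∃ d, r' = r + 1 + d := ⟨r' - (r+1), by omega⟩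
    induction d with
    | zero => exact hcol r c hc
    | succ d ih =>
      have := ih (by omega) (lt_of_lt_of_le hc (hanti (by omega)))
      have := hcol (r + 1 + d) c hc
      rw [← add_assoc]
      omega
  · intro i hi l hl
    simp only [zT]
    obtain ⟨r, hr⟩ : ∃ r, i - 1 - l = r := ⟨_, rfl⟩
    have hle := hz.up i (k-i) l (by omega) hl
    rw [show i + (k - i) = k by omega, show l + (k-i) = k - 1 - r by omega,
      ← hlam r (by omega)] at hle
    rw [hr]
    have : (Finset.range (revPart k x r)).filter (fun c => T r c < i) = Finset.range (z i l) := by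
      ext c
      simp only [Finset.mem_filter, Finset.mem_range]
      constructor
      · rintro ⟨h1, h2⟩
        have := (key r c i h1 hi).1 h2
        rw [show i - 1 - r = l by omega] at this
        exact this.2
      · intro h
        refine ⟨by omega, ?_⟩
        rw [key r c i (by omega) hi, show i - 1 - r = l by omega]
        exact ⟨by omega, h⟩
    rw [this, Finset.card_range]

theorem mem_cells (k : ℕ) (lam : ℕ → ℕ) (rc : ℕ × ℕ) :
    rc ∈ cells k lam ↔ rc.1 < k ∧ rc.2 < lam rc.1 := by
  simp only [cells, Finset.mem_filter, Finset.mem_product, Finset.mem_range]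
  constructor
  · rintro ⟨⟨h1, _⟩, h2⟩; exact ⟨h1, h2⟩
  · rintro ⟨h1, h2⟩
    exact ⟨⟨h1, lt_of_lt_of_le h2 (Finset.le_sup (f := lam) (Finset.mem_range.2 h1))⟩, h2⟩

theorem rSum_zT (hx : Chamb k x) (hT : IsSSYT k (revPart k x) T) (i : ℕ) (hi : i ≤ k) :
    rSum (zT (revPart k x) T) i =
      ((cells k (revPart k x)).filter (fun rc => T rc.1 rc.2 < i)).card := by
  have h1 : rSum (zT (revPart k x) T) i = ∑ r ∈ Finset.range i,
      ((Finset.range (revPart k x r)).filter (fun c => T r c < i)).card := by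
    rw [← Finset.sum_range_reflect]; rfl
  have h2 : ∑ r ∈ Finset.range i,
      ((Finset.range (revPart k x r)).filter (fun c => T r c < i)).card =
      ∑ r ∈ Finset.range k,
      ((Finset.range (revPart k x r)).filter (fun c => T r c < i)).card := by
    apply Finset.sum_subset
    · intro a ha; rw [Finset.mem_range] at *; omega
    · intro r _ hr
      rw [Finset.card_eq_zero, Finset.filter_eq_empty_iff]
      intro c hc
      have := ssyt_ge hx hT r c (Finset.mem_range.1 hc)
      rw [Finset.mem_range] at hr
      omega
  rw [h1, h2, ← Finset.card_sigma]
  apply Finset.card_bij (fun a _ => (a.1, a.2))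
  · rintro ⟨r, c⟩ h
    simp only [Finset.mem_sigma, Finset.mem_filter, Finset.mem_range, mem_cells] at h ⊢
    tauto
  · rintro ⟨r, c⟩ _ ⟨r', c'⟩ _ h
    simp only [Prod.mk.injEq] at h
    obtain ⟨rfl, rfl⟩ := h
    rfl
  · rintro ⟨r, c⟩ h
    refine ⟨⟨r, c⟩, ?_, rfl⟩
    simp only [Finset.mem_sigma, Finset.mem_filter, Finset.mem_range, mem_cells] at h ⊢
    tauto

theorem rSum_zT_succ (hx : Chamb k x) (hT : IsSSYT k (revPart k x) T) (i : ℕ) (hi : i < k) :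
    rSum (zT (revPart k x) T) (i+1) =
      rSum (zT (revPart k x) T) i + entryCount k (revPart k x) T i := by
  rw [rSum_zT hx hT _ hi, rSum_zT hx hT _ hi.le, entryCount, ← Finset.card_union_of_disjoint]
  · congr 1
    ext rc
    simp only [Finset.mem_union, Finset.mem_filter, ← and_or_left, Nat.lt_succ_iff_lt_or_eq]
  · rw [Finset.disjoint_left]
    intro rc h1 h2
    simp only [Finset.mem_filter] at h1 h2
    omega

theorem ssyt_finite (k : ℕ) (x : ℕ → ℕ) :
    Finite {T : ℕ → ℕ → ℕ // IsSSYT k (revPart k x) T} := by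
  let φ : {T : ℕ → ℕ → ℕ // IsSSYT k (revPart k x) T} → (cells k (revPart k x) → Fin k) :=
    fun T rc => ⟨T.1 rc.1.1 rc.1.2, T.2.1 _ _ ((mem_cells _ _ _).1 rc.2).2⟩
  apply Finite.of_injective φ
  rintro ⟨T, hT⟩ ⟨T', hT'⟩ h
  apply Subtype.ext
  funext r c
  by_cases hc : c < revPart k x r
  · have := congrFun h ⟨(r, c), (mem_cells _ _ _).2 ⟨revPart_lt hc, hc⟩⟩
    simpa [φ] using this
  · change T r c = T' r c
    rw [hT.2.1 r c hc, hT'.2.1 r c hc]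

end tab


theorem EqUp.refl (k : ℕ) (y : ℕ → ℕ → ℕ) : EqUp k y y := fun _ _ _ _ => rfl

section prob
variable {Ω : Type*} [MeasureSpace Ω] [IsProbabilityMeasure (ℙ : Measure Ω)]

/-- An event about the array after `n` letters. -/
def arrEv {Ω : Type*} (ξ : ℕ → Ω → ℕ) (k n : ℕ) (z : ℕ → ℕ → ℕ) : Set Ω :=
  {ω | EqUp k (arr (fun m => ξ m ω) n) z}

theorem arrEv_pre {Ω : Type*} (ξ : ℕ → Ω → ℕ) (k n : ℕ) (z : ℕ → ℕ → ℕ) :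
    arrEv ξ k n z = (fun ω (i : Finset.range n) => ξ i ω) ⁻¹'
      {t | EqUp k (arr (fun m => if h : m ∈ Finset.range n then t ⟨m, h⟩ else 0) n) z} := by
  ext ω
  change EqUp k (arr (fun m => ξ m ω) n) z ↔ EqUp k (arr (fun m => if h : m ∈ Finset.range n then
    ξ m ω else 0) n) z
  rw [arr_congr (fun m => ξ m ω) (fun m => if h : m ∈ Finset.range n then ξ m ω else 0) n]
  intro m hm
  simp [hm]

theorem arrEv_meas (ξ : ℕ → Ω → ℕ) (hmeas : ∀ m, Measurable (ξ m)) (k n : ℕ) (z : ℕ → ℕ → ℕ) :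
    MeasurableSet (arrEv ξ k n z) := by
  rw [arrEv_pre]
  have h : Measurable (fun ω (i : Finset.range n) => ξ i ω) :=
    measurable_pi_lambda _ (fun i => hmeas i)
  exact h MeasurableSet.of_discrete

theorem arrEv_indep (ξ : ℕ → Ω → ℕ) (hmeas : ∀ m, Measurable (ξ m)) (hindep : iIndepFun ξ ℙ)
    (k n j : ℕ) (z : ℕ → ℕ → ℕ) :
    ℙ (arrEv ξ k n z ∩ {ω | ξ n ω = j}) = ℙ (arrEv ξ k n z) * ℙ {ω | ξ n ω = j} := by
  have h := hindep.indepFun_finset (Finset.range n) {n} (by simp) hmeas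
  have hm : Measurable (fun t : (({n} : Finset ℕ) → ℕ) => t ⟨n, by simp⟩) :=
    measurable_pi_apply _
  have h2 := h.comp measurable_id hm
  have := h2.measure_inter_preimage_eq_mul
    {t | EqUp k (arr (fun m => if h : m ∈ Finset.range n then t ⟨m, h⟩ else 0) n) z} {j}
    MeasurableSet.of_discrete MeasurableSet.of_discrete
  rw [arrEv_pre]
  exact this

theorem arr_law (k : ℕ) (p : ℕ → ℝ)
    (hp0 : ∀ i, i < k → 0 ≤ p i)
    (hsum : ∑ i ∈ Finset.range k, p i = 1)
    (ξ : ℕ → Ω → ℕ) (hmeas : ∀ m, Measurable (ξ m))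
    (hindep : iIndepFun ξ ℙ)
    (hlaw : ∀ m i, i < k → ℙ {ω | ξ m ω = i} = ENNReal.ofReal (p i)) (n : ℕ) :
    ∀ z, IsGT k z → ∀ a : ℕ → ℕ, (∀ i, i < k → rSum z (i+1) = rSum z i + a i) →
    ℙ (arrEv ξ k n z) =
      ENNReal.ofReal ((∏ i ∈ Finset.range k, p i ^ a i) * (chN k n (z k) : ℝ)) := by
  classical
  induction n with
  | zero =>
    intro z hz a ha
    by_cases h : ∀ i, i < k → z k i = 0
    · have hz0 : ∀ i, i ≤ k → ∀ l, l < i → z i l = 0 := by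
        intro i hi l hl
        have := hz.up i (k-i) l (by omega) hl
        rw [show i + (k-i) = k by omega, h (l+(k-i)) (by omega)] at this
        omega
      have hr0 : ∀ i, i ≤ k → rSum z i = 0 := fun i hi =>
        Finset.sum_eq_zero (fun l hl => hz0 i hi l (Finset.mem_range.1 hl))
      have he : arrEv ξ k 0 z = Set.univ := by
        apply Set.eq_univ_of_forall
        intro ω i hi l hl
        rw [hz0 i hi l hl]; rfl
      rw [he, measure_univ, chN, if_pos h, Finset.prod_eq_one]
      · simp
      · intro i hi
        have hi := Finset.mem_range.1 hi
        have := ha i hi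
        rw [hr0 i hi.le, hr0 (i+1) hi] at this
        rw [show a i = 0 by omega, pow_zero]
    · have he : arrEv ξ k 0 z = ∅ := by
        rw [Set.eq_empty_iff_forall_notMem]
        intro ω hω
        exact h (fun i hi => (hω k le_rfl i hi).symm)
      rw [he, chN, if_neg h]
      simp
  | succ n ih =>
    intro z hz a ha
    have hae : ∀ᵐ ω ∂(ℙ : Measure Ω), ξ n ω < k := by
      have h1 : ℙ {ω | ξ n ω < k} = 1 := by
        have : {ω | ξ n ω < k} = ⋃ i ∈ Finset.range k, {ω | ξ n ω = i} := by
          ext ω; simp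
        rw [this, measure_biUnion_finset]
        · rw [Finset.sum_congr rfl (fun i hi => hlaw n i (Finset.mem_range.1 hi)),
            ← ENNReal.ofReal_sum_of_nonneg (fun i hi => hp0 i (Finset.mem_range.1 hi)), hsum]
          simp
        · intro i _ j _ hij
          change Disjoint _ _
          rw [Set.disjoint_left]
          intro ω h1 h2
          exact hij (h1.symm.trans h2)
        · intro i _
          exact hmeas n (measurableSet_singleton i)
      exact (prob_compl_eq_zero_iff (hmeas n measurableSet_Iio)).2 h1
    let A : ℕ → Set Ω := fun r => {ω | EqUp k (ins (arr (fun m => ξ m ω) n) (ξ n ω)) z ∧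
      ξ n ω < k ∧ sPos (arr (fun m => ξ m ω) n) (ξ n ω) k = r + 1}
    have hE : arrEv ξ k (n+1) z =ᵐ[ℙ] ⋃ r ∈ Finset.range k, A r := by
      filter_upwards [hae] with ω hω
      apply propext
      change EqUp k (ins (arr (fun m => ξ m ω) n) (ξ n ω)) z ↔ ω ∈ ⋃ r ∈ Finset.range k, A r
      simp only [Set.mem_iUnion, exists_prop, Finset.mem_range]
      constructor
      · intro h
        have h1 := sPos_pos (arr (fun m => ξ m ω) n) (ξ n ω) k hω
        have h2 := sPos_le (arr (fun m => ξ m ω) n) (ξ n ω) k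
        exact ⟨sPos (arr (fun m => ξ m ω) n) (ξ n ω) k - 1, by omega, h, hω, by omega⟩
      · rintro ⟨r, _, h, _⟩
        exact h
    have hA : ∀ r, r < k → MeasurableSet (A r) ∧ ℙ (A r) = ENNReal.ofReal
        ((∏ i ∈ Finset.range k, p i ^ a i) *
          ((if 0 < z k r ∧ Chamb k (decr (z k) r) then chN k n (decr (z k) r) else 0 : ℕ) : ℝ)) := by
      intro r hr
      by_cases hc : 0 < z k r ∧ Chamb k (decr (z k) r)
      · obtain ⟨z', j', hj', hz', htop, hiff⟩ := local_bij k z hz r hr hc.1 hc.2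
        have hAe : A r = arrEv ξ k n z' ∩ {ω | ξ n ω = j'} := by
          ext ω
          have hG := arr_GT (fun m => ξ m ω) n k
          constructor
          · rintro ⟨h1, h2, h3⟩
            exact (hiff _ _ hG h2).1 ⟨h1, h3⟩
          · rintro ⟨h1, h2⟩
            have h2 : ξ n ω = j' := h2
            have h3 : ξ n ω < k := by omega
            have := (hiff _ _ hG h3).2 ⟨h1, h2⟩
            exact ⟨this.1, h3, this.2⟩
        have hins := ((hiff z' j' hz' hj').2 ⟨EqUp.refl _ _, rfl⟩).1
        have hrs : ∀ i, i ≤ k → rSum z i = rSum z' i + if j' < i then 1 else 0 := by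
          intro i hi
          rw [← rSum_congr hins i hi, rSum_ins]
        let a' : ℕ → ℕ := fun i => rSum z' (i+1) - rSum z' i
        have ha' : ∀ i, i < k → rSum z' (i+1) = rSum z' i + a' i := by
          intro i hi
          have := hz'.rSum_le i hi
          simp only [a']; omega
        have haa : ∀ i, i < k → a i = a' i + if i = j' then 1 else 0 := by
          intro i hi
          have h1 := ha i hi
          have h2 := ha' i hi
          have h3 := hrs i hi.le
          have h4 := hrs (i+1) hi
          split_ifs at * <;> omega
        have hprod : ∏ i ∈ Finset.range k, p i ^ a i =
            (∏ i ∈ Finset.range k, p i ^ a' i) * p j' := by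
          rw [Finset.prod_congr rfl (fun i hi => by
            rw [haa i (Finset.mem_range.1 hi), pow_add]), Finset.prod_mul_distrib]
          congr 1
          rw [Finset.prod_eq_single j']
          · simp
          · intro b _ hb; simp [hb]
          · intro hb; exact absurd (Finset.mem_range.2 hj') hb
        rw [hAe]
        refine ⟨(arrEv_meas ξ hmeas k n z').inter (hmeas n (measurableSet_singleton j')), ?_⟩
        rw [arrEv_indep ξ hmeas hindep, ih z' hz' a' ha', hlaw n j' hj', if_pos hc, htop,
          ← ENNReal.ofReal_mul, hprod]
        · congr 1; ring
        · exact mul_nonneg (Finset.prod_nonneg (fun i hi =>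
            pow_nonneg (hp0 i (Finset.mem_range.1 hi)) _)) (Nat.cast_nonneg _)
      · have hAe : A r = ∅ := by
          rw [Set.eq_empty_iff_forall_notMem]
          rintro ω ⟨h1, h2, h3⟩
          apply hc
          have hG := (arr_GT (fun m => ξ m ω) n k).chamb
          have e : ∀ l, l < k → arr (fun m => ξ m ω) n k l + (if r = l then 1 else 0) = z k l := by
            intro l hl
            have := h1 k le_rfl l hl
            simp only [ins, h3] at this
            rw [← this]
            simp
          have hd : ∀ l, l < k → decr (z k) r l = arr (fun m => ξ m ω) n k l := by
            intro l hl
            have := e l hl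
            simp only [decr]
            by_cases hlr : l = r
            · subst hlr; rw [if_pos rfl] at this ⊢; omega
            · rw [if_neg hlr]; rw [if_neg (Ne.symm hlr)] at this; omega
          refine ⟨?_, ?_⟩
          · have := e r hr
            rw [if_pos rfl] at this
            omega
          · intro l hl
            rw [hd l (by omega), hd (l+1) hl]
            exact hG l hl
        rw [hAe, if_neg hc]
        simp
    rw [measure_congr hE, measure_biUnion_finset]
    · rw [Finset.sum_congr rfl (fun r hr => (hA r (Finset.mem_range.1 hr)).2),
        ← ENNReal.ofReal_sum_of_nonneg, ← Finset.mul_sum, chN, Nat.cast_sum]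
      intro r _
      exact mul_nonneg (Finset.prod_nonneg (fun i hi =>
            pow_nonneg (hp0 i (Finset.mem_range.1 hi)) _)) (Nat.cast_nonneg _)
    · intro r _ r' _ hne
      change Disjoint _ _
      rw [Set.disjoint_left]
      rintro ω ⟨_, _, h1⟩ ⟨_, _, h2⟩
      omega
    · intro r hr
      exact (hA r (Finset.mem_range.1 hr)).1

end prob

theorem chN_congr (k n : ℕ) : ∀ v w : ℕ → ℕ, (∀ l, l < k → v l = w l) →
    chN k n v = chN k n w := by
  classical
  induction n with
  | zero =>
    intro v w h
    simp only [chN]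
    apply if_congr _ rfl rfl
    constructor
    · intro h' i hi; rw [← h i hi]; exact h' i hi
    · intro h' i hi; rw [h i hi]; exact h' i hi
  | succ n ih =>
    intro v w h
    simp only [chN]
    apply Finset.sum_congr rfl
    intro r hr
    have hr := Finset.mem_range.1 hr
    have hd : ∀ l, l < k → decr v r l = decr w r l := by
      intro l hl
      simp only [decr, h l hl]
    rw [ih _ _ hd]
    apply if_congr _ rfl rfl
    rw [h r hr]
    apply and_congr_right
    intro _
    constructor
    · intro hc l hl; rw [← hd l (by omega), ← hd (l+1) hl]; exact hc l hl
    · intro hc l hl; rw [hd l (by omega), hd (l+1) hl]; exact hc l hl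

/-- `P(G^{(k)}(X)(n) = x) = s_{x^*}(p) · f(x)` where `f(x)` is the
number of chamber paths from the origin to `x` (equivalently, the number of
standard Young tableaux of shape `x^*`). -/
theorem stmt13 {Ω : Type*} [MeasureSpace Ω] [IsProbabilityMeasure (ℙ : Measure Ω)]
    (k : ℕ) (hk : 2 ≤ k) (p : ℕ → ℝ)
    (hp0 : ∀ i, i < k → 0 ≤ p i)
    (hsum : ∑ i ∈ Finset.range k, p i = 1)
    (ξ : ℕ → Ω → ℕ) (hmeas : ∀ m, Measurable (ξ m))
    (hindep : iIndepFun ξ ℙ)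
    (hlaw : ∀ m i, i < k → ℙ {ω | ξ m ω = i} = ENNReal.ofReal (p i))
    (n : ℕ) (hn : 1 ≤ n) (x : ℕ → ℕ)
    (hxW : ∀ i, i + 1 < k → x i ≤ x (i+1))
    (hxsum : ∑ i ∈ Finset.range k, x i = n) :
    ℙ {ω | ∀ i, i < k → G k (fun i' n' => Xcnt ξ i' n' ω) i n = (x i : ℤ)}
      = ENNReal.ofReal (schur k (revPart k x) p * (numChamberPaths k n x : ℝ)) := by
  have hx : Chamb k x := hxW
  have hfin := ssyt_finite k x
  have hft := Fintype.ofFinite {T : ℕ → ℕ → ℕ // IsSSYT k (revPart k x) T}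
  have hset : {ω | ∀ i, i < k → G k (fun i' n' => Xcnt ξ i' n' ω) i n = (x i : ℤ)} =
      ⋃ T : {T : ℕ → ℕ → ℕ // IsSSYT k (revPart k x) T},
        arrEv ξ k n (zT (revPart k x) T.1) := by
    ext ω
    rw [Set.mem_iUnion]
    have hG : ∀ i, i < k → G k (fun i' n' => Xcnt ξ i' n' ω) i n =
        (arr (fun m => ξ m ω) n k i : ℤ) := fun i hi => G_arr k (fun m => ξ m ω) i n hi
    constructor
    · intro h
      obtain ⟨T, hT, he⟩ := zT_surj hx (arr_GT (fun m => ξ m ω) n k) (fun l hl => by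
        have := h l hl
        rw [hG l hl] at this
        exact_mod_cast this)
      exact ⟨⟨T, hT⟩, fun i hi l hl => (he i hi l hl).symm⟩
    · rintro ⟨⟨T, hT⟩, he⟩ i hi
      rw [hG i hi, he k le_rfl i hi, zT_top hT i hi]
  have hpos : ∀ T : {T : ℕ → ℕ → ℕ // IsSSYT k (revPart k x) T},
      0 ≤ ∏ i ∈ Finset.range k, p i ^ entryCount k (revPart k x) T.1 i := fun T =>
    Finset.prod_nonneg (fun i hi => pow_nonneg (hp0 i (Finset.mem_range.1 hi)) _)
  have hone : ∀ T : {T : ℕ → ℕ → ℕ // IsSSYT k (revPart k x) T},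
      ℙ (arrEv ξ k n (zT (revPart k x) T.1)) = ENNReal.ofReal
        ((∏ i ∈ Finset.range k, p i ^ entryCount k (revPart k x) T.1 i) *
          (numChamberPaths k n x : ℝ)) := by
    intro T
    have hch := (zT_GT hx T.2).chamb
    rw [arr_law k p hp0 hsum ξ hmeas hindep hlaw n _ (zT_GT hx T.2)
      (entryCount k (revPart k x) T.1) (fun i hi => rSum_zT_succ hx T.2 i hi)]
    rw [numChamberPaths_eq k n x hx, chN_congr k n _ x (fun l hl => zT_top T.2 l hl)]
  rw [hset, measure_iUnion]
  · rw [schur, tsum_fintype, tsum_fintype, Finset.sum_mul, ENNReal.ofReal_sum_of_nonneg]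
    · exact Finset.sum_congr rfl (fun T _ => hone T)
    · intro T _
      exact mul_nonneg (hpos T) (Nat.cast_nonneg _)
  · intro T T' hne
    change Disjoint _ _
    rw [Set.disjoint_left]
    intro ω h1 h2
    apply hne
    apply Subtype.ext
    apply zT_inj hx T.2 T'.2
    intro i hi l hl
    rw [← h1 i hi l hl, ← h2 i hi l hl]
  · intro T
    exact arrEv_meas ξ hmeas k n _
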